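/- arXiv:2508.16462 — 4 statements merged into one kernel-verified Lean document; each statement's English description precedes it below -/
import Mathlib

section
/- The problem (P) is Levitin-Polyak well-posed in the extended sense if and only if it is weakly Levitin-Polyak well-posed in the extended sense and the set argmin(P) is compact. -/
open Metric Filter Topology Set ENNReal Bornology

noncomputable section

/-- The set of globally optimal solutions of problem (P):
minimize `f x` subject to `x ∈ M` and `x ∈ Q`, where `fstar` is the optimal value. -/
def argminP {X : Type*} (M Q : Set X) (f : X → EReal) (fstar : ℝ) : Set X :=
  {x | x ∈ M ∩ Q ∧ f x = (fstar : EReal)}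

/-- `phi` is a penalty term (infeasibility measure) for the constraint `x ∈ M` on `Q`. -/
def IsPenaltyTerm {X : Type*} (M Q : Set X) (phi : X → ℝ≥0∞) : Prop :=
  ∀ x ∈ Q, (phi x = 0 ↔ x ∈ M)

/-- The penalty function `F_c x = f x + c * phi x`. -/
def Pen {X : Type*} (f : X → EReal) (phi : X → ℝ≥0∞) (c : ℝ) (x : X) : EReal :=
  f x + (c : EReal) * (phi x : EReal)

/-- Some subsequence of `x` converges to a point of `S`. -/
def HasSubseqConvTo {X : Type*} [MetricSpace X] (x : ℕ → X) (S : Set X) : Prop :=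
  ∃ (σ : ℕ → ℕ) (p : X), StrictMono σ ∧ p ∈ S ∧ Tendsto (fun k => x (σ k)) atTop (𝓝 p)

/-- Problem (P) is Tykhonov well-posed in the extended sense. -/
def TykhonovWPExt {X : Type*} [MetricSpace X] (M Q : Set X) (f : X → EReal) (fstar : ℝ) :
    Prop :=
  (argminP M Q f fstar).Nonempty ∧
    ∀ x : ℕ → X, (∀ n, x n ∈ M ∩ Q) →
      Tendsto (fun n => f (x n)) atTop (𝓝 (fstar : EReal)) →
      HasSubseqConvTo x (argminP M Q f fstar)

/-- Problem (P) is weakly Tykhonov well-posed in the extended sense. -/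
def WeakTykhonovWPExt {X : Type*} [MetricSpace X] (M Q : Set X) (f : X → EReal) (fstar : ℝ) :
    Prop :=
  (argminP M Q f fstar).Nonempty ∧
    ∀ x : ℕ → X, (∀ n, x n ∈ M ∩ Q) →
      Tendsto (fun n => f (x n)) atTop (𝓝 (fstar : EReal)) →
      Tendsto (fun n => infDist (x n) (argminP M Q f fstar)) atTop (𝓝 0)

/-- Problem (P) is Levitin-Polyak well-posed in the extended sense. -/
def LevitinPolyakWPExt {X : Type*} [MetricSpace X] (M Q : Set X) (f : X → EReal) (fstar : ℝ) :
    Prop :=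
  (argminP M Q f fstar).Nonempty ∧
    ∀ x : ℕ → X,
      Tendsto (fun n => f (x n)) atTop (𝓝 (fstar : EReal)) →
      Tendsto (fun n => infDist (x n) (M ∩ Q)) atTop (𝓝 0) →
      HasSubseqConvTo x (argminP M Q f fstar)

/-- Problem (P) is weakly Levitin-Polyak well-posed in the extended sense. -/
def WeakLevitinPolyakWPExt {X : Type*} [MetricSpace X] (M Q : Set X) (f : X → EReal)
    (fstar : ℝ) : Prop :=
  (argminP M Q f fstar).Nonempty ∧
    ∀ x : ℕ → X,
      Tendsto (fun n => f (x n)) atTop (𝓝 (fstar : EReal)) →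
      Tendsto (fun n => infDist (x n) (M ∩ Q)) atTop (𝓝 0) →
      Tendsto (fun n => infDist (x n) (argminP M Q f fstar)) atTop (𝓝 0)

/-- Problem (P) is Levitin-Polyak well-posed with respect to the infeasibility measure `phi`. -/
def LevitinPolyakWPwrt {X : Type*} [MetricSpace X] (M Q : Set X) (f : X → EReal)
    (phi : X → ℝ≥0∞) (fstar : ℝ) : Prop :=
  (argminP M Q f fstar).Nonempty ∧
    ∀ x : ℕ → X,
      Tendsto (fun n => f (x n)) atTop (𝓝 (fstar : EReal)) →
      Tendsto (fun n => phi (x n)) atTop (𝓝 (0 : ℝ≥0∞)) →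
      HasSubseqConvTo x (argminP M Q f fstar)

/-- Problem (P) is weakly Levitin-Polyak well-posed with respect to the infeasibility
measure `phi`. -/
def WeakLevitinPolyakWPwrt {X : Type*} [MetricSpace X] (M Q : Set X) (f : X → EReal)
    (phi : X → ℝ≥0∞) (fstar : ℝ) : Prop :=
  (argminP M Q f fstar).Nonempty ∧
    ∀ x : ℕ → X,
      Tendsto (fun n => f (x n)) atTop (𝓝 (fstar : EReal)) →
      Tendsto (fun n => phi (x n)) atTop (𝓝 (0 : ℝ≥0∞)) →
      Tendsto (fun n => infDist (x n) (argminP M Q f fstar)) atTop (𝓝 0)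

/-- If every subsequence of `x` has a further subsequence converging to a point of `S`, then the
distances from `x n` to `S` tend to zero. -/
lemma tendsto_infDist_of_hasSubseqConvTo {X : Type*} [MetricSpace X] {x : ℕ → X} {S : Set X}
    (h : ∀ ns : ℕ → ℕ, Tendsto ns atTop atTop → HasSubseqConvTo (x ∘ ns) S) :
    Tendsto (fun n => infDist (x n) S) atTop (𝓝 0) := by
  refine tendsto_of_subseq_tendsto fun ns hns => ?_
  obtain ⟨σ, p, -, hp, hlim⟩ := h ns hns
  refine ⟨σ, ?_⟩
  have hcont := ((continuous_infDist_pt S).tendsto p).comp hlim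
  rwa [infDist_zero_of_mem hp] at hcont

/-- A sequence whose distances to a nonempty compact set tend to zero has a subsequence
converging to a point of that set. -/
lemma IsCompact.hasSubseqConvTo {X : Type*} [MetricSpace X] {x : ℕ → X} {S : Set X}
    (hS : IsCompact S) (hne : S.Nonempty)
    (hx : Tendsto (fun n => infDist (x n) S) atTop (𝓝 0)) : HasSubseqConvTo x S := by
  choose a haS ha using fun n => hS.exists_infDist_eq_dist hne (x n)
  obtain ⟨p, hp, σ, hσ, hlim⟩ := hS.tendsto_subseq haS
  refine ⟨σ, p, hσ, hp, hlim.congr_dist ?_⟩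
  refine (hx.comp hσ.tendsto_atTop).congr fun k => ?_
  simp only [Function.comp_apply, ha, dist_comm]

/-- (P) is Levitin-Polyak well-posed in the extended sense iff it is
weakly Levitin-Polyak well-posed in the extended sense and `argmin(P)` is compact. -/
theorem stmt2 {X : Type*} [MetricSpace X] (M Q : Set X) (f : X → EReal) (fstar : ℝ)
    (hM : M.Nonempty) (hQ : Q.Nonempty) (hfeas : (M ∩ Q).Nonempty)
    (hopt : (⨅ x ∈ M ∩ Q, f x) = (fstar : EReal)) :
    LevitinPolyakWPExt M Q f fstar ↔
      WeakLevitinPolyakWPExt M Q f fstar ∧ IsCompact (argminP M Q f fstar) := by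
  constructor
  · rintro ⟨hne, h⟩
    refine ⟨⟨hne, fun x hf hd => ?_⟩, ?_⟩
    · exact tendsto_infDist_of_hasSubseqConvTo fun ns hns =>
        h (x ∘ ns) (hf.comp hns) (hd.comp hns)
    · refine IsSeqCompact.isCompact fun x hx => ?_
      obtain ⟨σ, p, hσ, hp, hlim⟩ := h x
        (tendsto_const_nhds.congr fun n => (hx n).2.symm)
        (tendsto_const_nhds.congr fun n => (infDist_zero_of_mem (hx n).1).symm)
      exact ⟨p, hp, σ, hσ, hlim⟩
  · rintro ⟨⟨hne, h⟩, hc⟩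
    exact ⟨hne, fun x hf hd => hc.hasSubseqConvTo hne (h x hf hd)⟩
end
end

section
/- Let X be a real normed space and let f be uniformly continuous on bounded sets. If the problem (P) is weakly Tykhonov well-posed in the extended sense and liminf_{(R,δ)→(+∞,0)} inf{ f(x) : x ∈ X \ Ω, dist(x, Ω) < δ, ‖x‖ ≥ R } > f_*, then (P) is weakly Levitin-Polyak well-posed in the extended sense. Moreover, if the set argmin(P) is bounded, then these two conditions are also necessary for (P) to be weakly Levitin-Polyak well-posed in the extended sense. -/
open Metric Filter Topology Set ENNReal Bornology

noncomputable section

/-- `x` converges weakly to `p` (i.e. `l (x n) → l p` for every continuous linear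
functional `l`). -/
def WeakSeqConv {X : Type*} [NormedAddCommGroup X] [NormedSpace ℝ X] (x : ℕ → X) (p : X) :
    Prop :=
  ∀ l : X →L[ℝ] ℝ, Tendsto (fun n => l (x n)) atTop (𝓝 (l p))

/-- `Q` is weakly sequentially closed. -/
def WeaklySeqClosed {X : Type*} [NormedAddCommGroup X] [NormedSpace ℝ X] (Q : Set X) :
    Prop :=
  ∀ (x : ℕ → X) (p : X), (∀ n, x n ∈ Q) → WeakSeqConv x p → p ∈ Q

/-- `g` is weakly sequentially lower semicontinuous on `Q`. -/
def WeaklySeqLSCOn {X : Type*} [NormedAddCommGroup X] [NormedSpace ℝ X] {E : Type*}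
    [CompleteLattice E] (g : X → E) (Q : Set X) : Prop :=
  ∀ (x : ℕ → X) (p : X), (∀ n, x n ∈ Q) → p ∈ Q → WeakSeqConv x p →
    g p ≤ Filter.liminf (fun n => g (x n)) atTop

/-- `g` is weakly sequentially lower semicontinuous. -/
def WeaklySeqLSC {X : Type*} [NormedAddCommGroup X] [NormedSpace ℝ X] {E : Type*}
    [CompleteLattice E] (g : X → E) : Prop :=
  ∀ (x : ℕ → X) (p : X), WeakSeqConv x p →
    g p ≤ Filter.liminf (fun n => g (x n)) atTop

/-- Sequential characterization (Eberlein–Šmulian) of reflexivity of a Banach space: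
every bounded sequence has a weakly convergent subsequence. -/
def ReflexiveSeq (X : Type*) [NormedAddCommGroup X] [NormedSpace ℝ X] : Prop :=
  ∀ x : ℕ → X, IsBounded (Set.range x) →
    ∃ (σ : ℕ → ℕ) (p : X), StrictMono σ ∧ WeakSeqConv (fun k => x (σ k)) p

/-- `F_c` is strongly non-degenerate. -/
def StronglyNondegenerate {X : Type*} [NormedAddCommGroup X] (M Q : Set X) (f : X → EReal)
    (phi : X → ℝ≥0∞) : Prop :=
  ∃ cs : ℝ, 0 ≤ cs ∧ ∃ xc : ℝ → X,
    (∀ c ≥ cs, xc c ∈ Q ∧ ∀ y ∈ Q, Pen f phi c (xc c) ≤ Pen f phi c y) ∧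
    IsBounded (xc '' Ici cs) ∧
    Tendsto (fun c => infDist (xc c) (M ∩ Q)) atTop (𝓝 0)

/-- `f` is uniformly continuous on bounded sets (for an extended-real-valued `f`). -/
def UnifContOnBddEReal {X : Type*} [NormedAddCommGroup X] (f : X → EReal) : Prop :=
  ∀ s : Set X, IsBounded s → ∀ ε : ℝ, 0 < ε →
    ∃ δ > (0 : ℝ), ∀ x ∈ s, ∀ y ∈ s, dist x y < δ → f x ≤ f y + (ε : EReal)

/-- The condition
`liminf_{(R,δ)→(+∞,0⁺)} inf { f x : x ∉ Ω, dist(x, Ω) < δ, ‖x‖ ≥ R } > f_*`. -/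
def FarInfeasCond {X : Type*} [NormedAddCommGroup X] (M Q : Set X) (f : X → EReal)
    (fstar : ℝ) : Prop :=
  (fstar : EReal) <
    Filter.liminf
      (fun p : ℝ × ℝ =>
        ⨅ x ∈ {x : X | x ∉ M ∩ Q ∧ infDist x (M ∩ Q) < p.2 ∧ p.1 ≤ ‖x‖}, f x)
      ((atTop : Filter ℝ) ×ˢ 𝓝[>] (0 : ℝ))

/-- A function that is uniformly continuous on bounded sets and has a finite value at one
point is real-valued and the associated real function is uniformly continuous on bounded sets. -/
theorem UnifContOnBddEReal.exists_real {X : Type*} [NormedAddCommGroup X] [NormedSpace ℝ X]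
    {f : X → EReal} (hf : UnifContOnBddEReal f) {x₀ : X} (htop : f x₀ ≠ ⊤) (hbot : f x₀ ≠ ⊥) :
    ∃ g : X → ℝ, (∀ x, f x = (g x : EReal)) ∧
      ∀ s : Set X, IsBounded s → ∀ ε : ℝ, 0 < ε →
        ∃ δ > (0 : ℝ), ∀ x ∈ s, ∀ y ∈ s, dist x y < δ → g x ≤ g y + ε := by
  have near : ∀ x, ∀ᶠ y in 𝓝 x, f x ≤ f y + ((1 : ℝ) : EReal) ∧ f y ≤ f x + ((1 : ℝ) : EReal) := by
    intro x
    obtain ⟨δ, hδ, h⟩ := hf (ball x 1) isBounded_ball 1 one_pos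
    filter_upwards [ball_mem_nhds x hδ, ball_mem_nhds x one_pos] with y hy hy1
    exact ⟨h x (mem_ball_self one_pos) y hy1 (by rwa [dist_comm]),
      h y hy1 x (mem_ball_self one_pos) hy⟩
  have add_one_top : ∀ a b : EReal, a ≤ b + ((1 : ℝ) : EReal) → a = ⊤ → b = ⊤ := by
    rintro a b h rfl
    induction b with
    | bot => simp at h
    | coe b => exact absurd (top_le_iff.1 h) (by rw [← EReal.coe_add]; exact EReal.coe_ne_top _)
    | top => rfl
  have add_one_bot : ∀ a b : EReal, a ≤ b + ((1 : ℝ) : EReal) → b = ⊥ → a = ⊥ := by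
    rintro a b h rfl
    simpa using h
  have top_const : IsLocallyConstant fun x => f x = ⊤ := by
    rw [IsLocallyConstant.iff_eventually_eq]
    intro x
    filter_upwards [near x] with y hy
    exact propext ⟨add_one_top _ _ hy.2, add_one_top _ _ hy.1⟩
  have bot_const : IsLocallyConstant fun x => f x = ⊥ := by
    rw [IsLocallyConstant.iff_eventually_eq]
    intro x
    filter_upwards [near x] with y hy
    exact propext ⟨add_one_bot _ _ hy.1, add_one_bot _ _ hy.2⟩
  have coe_toReal : ∀ x, f x = ((f x).toReal : EReal) := fun x =>
    (EReal.coe_toReal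
      (fun h => htop ((top_const.apply_eq_of_preconnectedSpace x x₀).mp h))
      (fun h => hbot ((bot_const.apply_eq_of_preconnectedSpace x x₀).mp h))).symm
  refine ⟨fun x => (f x).toReal, coe_toReal, fun s hs ε hε => ?_⟩
  obtain ⟨δ, hδ, h⟩ := hf s hs ε hε
  refine ⟨δ, hδ, fun x hx y hy hxy => ?_⟩
  have := h x hx y hy hxy
  rw [coe_toReal x, coe_toReal y] at this
  exact_mod_cast this

/-- A real function that is uniformly continuous on bounded sets is continuous. -/
theorem continuous_of_unifCont_on_bounded {X : Type*} [NormedAddCommGroup X] {g : X → ℝ}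
    (hg : ∀ s : Set X, IsBounded s → ∀ ε : ℝ, 0 < ε →
      ∃ δ > (0 : ℝ), ∀ x ∈ s, ∀ y ∈ s, dist x y < δ → g x ≤ g y + ε) :
    Continuous g := by
  rw [Metric.continuous_iff]
  intro x ε hε
  obtain ⟨δ, hδ, h⟩ := hg (ball x 1) isBounded_ball (ε / 2) (half_pos hε)
  refine ⟨min δ 1, lt_min hδ one_pos, fun y hy => ?_⟩
  have hyδ := hy.trans_le (min_le_left _ _)
  have hy1 : y ∈ ball x 1 := hy.trans_le (min_le_right _ _)
  have h₁ := h x (mem_ball_self one_pos) y hy1 (by rwa [dist_comm])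
  have h₂ := h y hy1 x (mem_ball_self one_pos) hyδ
  rw [Real.dist_eq, abs_lt]
  constructor <;> linarith

theorem FarInfeasCond.exists_forall_lt {X : Type*} [NormedAddCommGroup X] {M Q : Set X}
    {f : X → EReal} {fstar : ℝ} (h : FarInfeasCond M Q f fstar) :
    ∃ (c : EReal) (R δ : ℝ), (fstar : EReal) < c ∧ 0 < δ ∧
      ∀ x, x ∉ M ∩ Q → infDist x (M ∩ Q) < δ → R ≤ ‖x‖ → c < f x := by
  obtain ⟨c, hc, hc'⟩ := exists_between h
  have hev := eventually_lt_of_lt_liminf hc'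
  have hpos : ∀ᶠ p : ℝ × ℝ in (atTop : Filter ℝ) ×ˢ 𝓝[>] (0 : ℝ), 0 < p.2 :=
    tendsto_snd.eventually self_mem_nhdsWithin
  obtain ⟨p, hp, hp2⟩ := (hev.and hpos).exists
  exact ⟨c, p.1, p.2, hc, hp2, fun x h₁ h₂ h₃ => hp.trans_le (iInf₂_le x ⟨h₁, h₂, h₃⟩)⟩

theorem exists_far_lt_of_not_farInfeasCond {X : Type*} [NormedAddCommGroup X] {M Q : Set X}
    {f : X → EReal} {fstar : ℝ} (h : ¬ FarInfeasCond M Q f fstar) (R : ℝ) {ε : ℝ}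
    (hε : 0 < ε) :
    ∃ x, infDist x (M ∩ Q) < ε ∧ R ≤ ‖x‖ ∧ f x < ((fstar + ε : ℝ) : EReal) := by
  by_contra! hcon
  refine h (lt_of_lt_of_le (b := ((fstar + ε : ℝ) : EReal))
    (EReal.coe_lt_coe_iff.2 (by linarith)) (le_liminf_of_le (by isBoundedDefault) ?_))
  have hR : ∀ᶠ p : ℝ × ℝ in (atTop : Filter ℝ) ×ˢ 𝓝[>] (0 : ℝ), R ≤ p.1 :=
    tendsto_fst.eventually (eventually_ge_atTop R)
  have hδ : ∀ᶠ p : ℝ × ℝ in (atTop : Filter ℝ) ×ˢ 𝓝[>] (0 : ℝ), p.2 < ε :=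
    tendsto_snd.eventually (mem_nhdsWithin_of_mem_nhds (Iio_mem_nhds hε))
  filter_upwards [hR, hδ] with p hp₁ hp₂
  exact le_iInf₂ fun x hx => hcon x (hx.2.1.trans hp₂) (hp₁.trans hx.2.2)

theorem WeakLevitinPolyakWPExt.weakTykhonovWPExt {X : Type*} [MetricSpace X] {M Q : Set X}
    {f : X → EReal} {fstar : ℝ} (h : WeakLevitinPolyakWPExt M Q f fstar) :
    WeakTykhonovWPExt M Q f fstar :=
  ⟨h.1, fun x hx hfx => h.2 x hfx (by simp [fun n => infDist_zero_of_mem (hx n)])⟩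

/-- Weak Tykhonov well-posedness and the far infeasibility condition imply weak Levitin-Polyak
well-posedness. -/
theorem WeakTykhonovWPExt.weakLevitinPolyakWPExt {X : Type*} [NormedAddCommGroup X]
    {M Q : Set X} {f : X → EReal} {fstar : ℝ} {g : X → ℝ} (hfeas : (M ∩ Q).Nonempty)
    (hfg : ∀ x, f x = (g x : EReal))
    (hg : ∀ s : Set X, IsBounded s → ∀ ε : ℝ, 0 < ε →
      ∃ δ > (0 : ℝ), ∀ x ∈ s, ∀ y ∈ s, dist x y < δ → g x ≤ g y + ε)
    (hT : WeakTykhonovWPExt M Q f fstar) (hF : FarInfeasCond M Q f fstar) :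
    WeakLevitinPolyakWPExt M Q f fstar := by
  refine ⟨hT.1, fun x hfx hdx => ?_⟩
  obtain ⟨c, R, δ, hc, hδ, hfar⟩ := hF.exists_forall_lt
  have near : ∀ n : ℕ, ∃ y ∈ M ∩ Q, dist (x n) y < infDist (x n) (M ∩ Q) + 1 / ((n : ℝ) + 1) ∧
      (x n ∈ M ∩ Q → y = x n) := by
    intro n
    have hn : (0 : ℝ) < 1 / ((n : ℝ) + 1) := by positivity
    by_cases hx : x n ∈ M ∩ Q
    · exact ⟨x n, hx, by rw [dist_self, infDist_zero_of_mem hx]; linarith, fun _ => rfl⟩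
    · obtain ⟨y, hy, hxy⟩ :=
        (infDist_lt_iff hfeas).1 (lt_add_of_pos_right (infDist (x n) (M ∩ Q)) hn)
      exact ⟨y, hy, hxy, fun h => absurd h hx⟩
  choose y hyΩ hxy hyx using near
  have hdist : Tendsto (fun n => dist (x n) (y n)) atTop (𝓝 0) :=
    squeeze_zero (fun _ => dist_nonneg) (fun n => (hxy n).le)
      (by simpa using hdx.add tendsto_one_div_add_atTop_nhds_zero_nat)
  have hgx : Tendsto (fun n => g (x n)) atTop (𝓝 fstar) := by
    simpa only [hfg, EReal.tendsto_coe] using hfx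
  have hdiff : Tendsto (fun n => g (y n) - g (x n)) atTop (𝓝 0) := by
    rw [Metric.tendsto_nhds]
    intro ε hε
    obtain ⟨η, hη, hunif⟩ := hg (ball 0 (R + 1)) isBounded_ball (ε / 2) (half_pos hε)
    filter_upwards [hfx.eventually (gt_mem_nhds hc), hdx.eventually (gt_mem_nhds hδ),
      hdist.eventually (gt_mem_nhds hη), hdist.eventually (gt_mem_nhds one_pos)] with n h₁ h₂ h₃ h₄
    by_cases hx : x n ∈ M ∩ Q
    · simpa [hyx n hx] using hε
    have hxR : ‖x n‖ < R := not_le.1 fun h => (hfar _ hx h₂ h).not_gt h₁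
    have hxb : x n ∈ ball (0 : X) (R + 1) := by rw [mem_ball_zero_iff]; linarith
    have hyb : y n ∈ ball (0 : X) (R + 1) := by
      rw [mem_ball_zero_iff]
      have := norm_le_norm_add_norm_sub (x n) (y n)
      rw [← dist_eq_norm] at this
      linarith
    have h₅ := hunif _ hxb _ hyb h₃
    have h₆ := hunif _ hyb _ hxb (by rwa [dist_comm])
    rw [Real.dist_eq, sub_zero, abs_lt]
    constructor <;> linarith
  have hfy : Tendsto (fun n => f (y n)) atTop (𝓝 (fstar : EReal)) := by
    simp only [hfg, EReal.tendsto_coe]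
    simpa using hdiff.add hgx
  exact squeeze_zero (fun _ => infDist_nonneg)
    (fun n => infDist_le_infDist_add_dist (x := x n) (y := y n))
    (by simpa using (hT.2 y hyΩ hfy).add hdist)

/-- If the solution set is bounded, weak Levitin-Polyak well-posedness implies the far
infeasibility condition. -/
theorem WeakLevitinPolyakWPExt.farInfeasCond {X : Type*} [NormedAddCommGroup X]
    [NormedSpace ℝ X] {M Q : Set X} {f : X → EReal} {fstar : ℝ} {g : X → ℝ}
    (hfeas : (M ∩ Q).Nonempty) (hfg : ∀ x, f x = (g x : EReal)) (hg : Continuous g)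
    (hle : ∀ x ∈ M ∩ Q, fstar ≤ g x) (hb : IsBounded (argminP M Q f fstar))
    (hLP : WeakLevitinPolyakWPExt M Q f fstar) : FarInfeasCond M Q f fstar := by
  by_contra hF
  have key : ∀ n : ℕ, ∃ z, infDist z (M ∩ Q) ≤ 2 * (1 / ((n : ℝ) + 1)) ∧ (n : ℝ) - 1 ≤ ‖z‖ ∧
      fstar ≤ g z ∧ g z ≤ fstar + 1 / ((n : ℝ) + 1) := by
    intro n
    have hn : (0 : ℝ) < 1 / ((n : ℝ) + 1) := by positivity
    have hn1 : 1 / ((n : ℝ) + 1) ≤ 1 := by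
      rw [div_le_one (by positivity)]
      linarith [n.cast_nonneg (α := ℝ)]
    obtain ⟨x, hxd, hxn, hxf⟩ := exists_far_lt_of_not_farInfeasCond hF n hn
    rw [hfg, EReal.coe_lt_coe_iff] at hxf
    rcases le_total fstar (g x) with hx | hx
    · exact ⟨x, by linarith, by linarith, hx, hxf.le⟩
    obtain ⟨y, hy, hxy⟩ := (infDist_lt_iff hfeas).1 hxd
    obtain ⟨z, hz, hgz⟩ := (convex_segment (𝕜 := ℝ) x y).isPreconnected.intermediate_value
      (left_mem_segment ℝ x y) (right_mem_segment ℝ x y) hg.continuousOn ⟨hx, hle y hy⟩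
    have hzx : dist z x ≤ dist x y := by
      have := dist_add_dist_of_mem_segment hz
      rw [dist_comm z x]
      linarith [dist_nonneg (x := z) (y := y)]
    refine ⟨z, ?_, ?_, hgz.ge, by linarith⟩
    · have := infDist_le_infDist_add_dist (s := M ∩ Q) (x := z) (y := x)
      linarith
    · have := norm_le_norm_add_norm_sub z x
      rw [← dist_eq_norm] at this
      linarith
  choose z hzd hzn hgz₁ hgz₂ using key
  have h0 := tendsto_one_div_add_atTop_nhds_zero_nat (𝕜 := ℝ)
  have hfz : Tendsto (fun n => f (z n)) atTop (𝓝 (fstar : EReal)) := by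
    simp only [hfg, EReal.tendsto_coe]
    exact tendsto_of_tendsto_of_tendsto_of_le_of_le tendsto_const_nhds
      (by simpa using h0.const_add fstar) hgz₁ hgz₂
  have hdz : Tendsto (fun n => infDist (z n) (M ∩ Q)) atTop (𝓝 0) :=
    squeeze_zero (fun _ => infDist_nonneg) hzd (by simpa using h0.const_mul 2)
  obtain ⟨C, hC⟩ := hb.exists_norm_le
  obtain ⟨n, hn, hnC⟩ := (((hLP.2 z hfz hdz).eventually (gt_mem_nhds one_pos)).and
    (tendsto_natCast_atTop_atTop.eventually (eventually_ge_atTop (C + 2)))).exists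
  obtain ⟨p, hp, hpz⟩ := (infDist_lt_iff hLP.1).1 hn
  have h₁ := norm_le_norm_add_norm_sub p (z n)
  rw [← dist_eq_norm, dist_comm] at h₁
  linarith [hC p hp, hzn n]

/-- If `f` is uniformly continuous on bounded sets, then weak Tykhonov
well-posedness in the extended sense together with the far infeasibility condition imply
weak Levitin-Polyak well-posedness in the extended sense; and, if `argmin(P)` is bounded,
these two conditions are also necessary. -/
theorem stmt3 {X : Type*} [NormedAddCommGroup X] [NormedSpace ℝ X] (M Q : Set X)
    (f : X → EReal) (fstar : ℝ)
    (hM : M.Nonempty) (hQ : Q.Nonempty) (hfeas : (M ∩ Q).Nonempty)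
    (hopt : (⨅ x ∈ M ∩ Q, f x) = (fstar : EReal))
    (hf : UnifContOnBddEReal f) :
    ((WeakTykhonovWPExt M Q f fstar ∧ FarInfeasCond M Q f fstar) →
        WeakLevitinPolyakWPExt M Q f fstar) ∧
      (IsBounded (argminP M Q f fstar) →
        (WeakLevitinPolyakWPExt M Q f fstar →
          WeakTykhonovWPExt M Q f fstar ∧ FarInfeasCond M Q f fstar)) := by
  obtain ⟨x₀, hx₀, hx₀_top⟩ : ∃ x ∈ M ∩ Q, f x ≠ ⊤ := by
    by_contra! h
    exact EReal.coe_ne_top fstar (hopt.symm.trans (iInf₂_eq_top.2 h))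
  have hle : ∀ x ∈ M ∩ Q, (fstar : EReal) ≤ f x := fun x hx => hopt ▸ iInf₂_le x hx
  have hx₀_bot : f x₀ ≠ ⊥ := ((EReal.bot_lt_coe fstar).trans_le (hle x₀ hx₀)).ne'
  obtain ⟨g, hfg, hg⟩ := hf.exists_real hx₀_top hx₀_bot
  refine ⟨fun h => h.1.weakLevitinPolyakWPExt hfeas hfg hg h.2, fun hb hLP =>
    ⟨hLP.weakTykhonovWPExt, hLP.farInfeasCond hfeas hfg (continuous_of_unifCont_on_bounded hg)
      (fun x hx => ?_) hb⟩⟩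
  have := hle x hx
  rwa [hfg, EReal.coe_le_coe_iff] at this
end
end

section
/- Let the problem (P) be Levitin-Polyak well-posed with respect to the infeasibility measure φ. Then the penalty function F_c is globally exact if and only if the following three conditions hold: (1) F_c has the zero duality gap property; (2) there exists c_0 ≥ 0 such that F_c attains a global minimum on Q for every c ≥ c_0; (3) F_c is locally exact at every globally optimal solution of (P). -/
open Metric Filter Topology Set ENNReal Bornology

noncomputable section

/-- `F` attains a global minimum on `Q`. -/
def AttainsGlobMin {X : Type*} (F : X → EReal) (Q : Set X) : Prop :=
  ∃ x ∈ Q, ∀ y ∈ Q, F x ≤ F y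

/-- The penalty function `F_c` is globally exact: for all sufficiently large `c ≥ 0`
the set of global minimizers of `F_c` on `Q` coincides with `argminP`. -/
def GloballyExactPen {X : Type*} (M Q : Set X) (f : X → EReal) (phi : X → ℝ≥0∞)
    (fstar : ℝ) : Prop :=
  ∃ cs : ℝ, 0 ≤ cs ∧ ∀ c ≥ cs,
    {x | x ∈ Q ∧ ∀ y ∈ Q, Pen f phi c x ≤ Pen f phi c y} = argminP M Q f fstar

/-- The zero duality gap property: `sup_{c ≥ 0} inf_{x ∈ Q} F_c x = fstar`. -/
def ZeroDualityGap {X : Type*} (Q : Set X) (f : X → EReal) (phi : X → ℝ≥0∞) (fstar : ℝ) :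
    Prop :=
  (⨆ c : ℝ, ⨆ _ : (0 : ℝ) ≤ c, ⨅ x ∈ Q, Pen f phi c x) = (fstar : EReal)

/-- `x₀` is a local minimizer of `F` on `Q`. -/
def IsLocalMinOnSet {X : Type*} [MetricSpace X] (F : X → EReal) (Q : Set X) (x₀ : X) : Prop :=
  ∃ r > (0 : ℝ), ∀ x ∈ Q, dist x x₀ ≤ r → F x₀ ≤ F x

/-- The penalty function `F_c` is locally exact at `x₀`. -/
def LocallyExactAt {X : Type*} [MetricSpace X] (f : X → EReal) (phi : X → ℝ≥0∞)
    (Q : Set X) (x₀ : X) : Prop :=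
  ∃ cs : ℝ, 0 ≤ cs ∧ ∀ c ≥ cs, IsLocalMinOnSet (Pen f phi c) Q x₀

/-- The least exact penalty parameter `c_*(x₀)` at `x₀`. -/
def penCStarAt {X : Type*} [MetricSpace X] (f : X → EReal) (phi : X → ℝ≥0∞)
    (Q : Set X) (x₀ : X) : ℝ :=
  sInf {cs : ℝ | 0 ≤ cs ∧ ∀ c ≥ cs, IsLocalMinOnSet (Pen f phi c) Q x₀}

/-- The radius of local exactness `r_*(x₀, cs)`: the supremum of all `r > 0` such that
`F_c x ≥ F_c x₀` for every `x ∈ B(x₀, r) ∩ Q` and every `c ≥ cs` (as an extended real). -/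
def penRadiusAt {X : Type*} [MetricSpace X] (f : X → EReal) (phi : X → ℝ≥0∞)
    (Q : Set X) (x₀ : X) (cs : ℝ) : EReal :=
  sSup (Real.toEReal ''
    {r : ℝ | 0 < r ∧ ∀ c ≥ cs, ∀ x ∈ Q, dist x x₀ ≤ r → Pen f phi c x₀ ≤ Pen f phi c x})

/-- `F_c` is uniformly locally exact at globally optimal solutions of (P). -/
def UniformlyLocallyExact {X : Type*} [MetricSpace X] (M Q : Set X) (f : X → EReal)
    (phi : X → ℝ≥0∞) (fstar : ℝ) : Prop :=
  (∀ x₀ ∈ argminP M Q f fstar, LocallyExactAt f phi Q x₀) ∧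
    ∃ cs rs : ℝ, 0 < cs ∧ 0 < rs ∧
      ∀ x₀ ∈ argminP M Q f fstar,
        penCStarAt f phi Q x₀ < cs ∧ (rs : EReal) ≤ penRadiusAt f phi Q x₀ cs

/-- `F_c` is non-degenerate in the extended sense. -/
def NondegenerateExt {X : Type*} [MetricSpace X] (M Q : Set X) (f : X → EReal)
    (phi : X → ℝ≥0∞) : Prop :=
  ∃ cs : ℝ, 0 ≤ cs ∧ ∃ xc : ℝ → X,
    (∀ c ≥ cs, xc c ∈ Q ∧ ∀ y ∈ Q, Pen f phi c (xc c) ≤ Pen f phi c y) ∧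
    Tendsto (fun c => infDist (xc c) (M ∩ Q)) atTop (𝓝 0)

theorem Pen_mono_param {X : Type*} (f : X → EReal) (phi : X → ℝ≥0∞) {c d : ℝ} (h : c ≤ d)
    (x : X) : Pen f phi c x ≤ Pen f phi d x := by
  unfold Pen
  gcongr

theorem Pen_of_phi_eq_zero {X : Type*} (f : X → EReal) {phi : X → ℝ≥0∞} (c : ℝ) {x : X}
    (h : phi x = 0) : Pen f phi c x = f x := by
  simp [Pen, h]

theorem Pen_of_mem_argminP {X : Type*} {M Q : Set X} {f : X → EReal} {phi : X → ℝ≥0∞}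
    {fstar : ℝ} (hphi : IsPenaltyTerm M Q phi) {x : X} (hx : x ∈ argminP M Q f fstar) (c : ℝ) :
    Pen f phi c x = fstar := by
  rw [Pen_of_phi_eq_zero f c ((hphi x hx.1.2).2 hx.1.1), hx.2]

/-- Real bounds on the penalty function for two parameters force both `f` and `phi` to be
finite. -/
theorem exists_real_of_Pen_bounds {X : Type*} {f : X → EReal} {phi : X → ℝ≥0∞} {c d a b : ℝ}
    {x : X} (hd : 0 < d) (ha : (a : EReal) ≤ Pen f phi c x)
    (hb : Pen f phi d x ≤ (b : EReal)) :
    ∃ u p : ℝ, 0 ≤ p ∧ f x = (u : EReal) ∧ phi x = ENNReal.ofReal p ∧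
      a ≤ u + c * p ∧ u + d * p ≤ b := by
  unfold Pen at ha hb
  have hbot : f x ≠ ⊥ := by
    intro h
    simp [h] at ha
  have hp : phi x ≠ ⊤ := by
    intro h
    rw [h, EReal.coe_ennreal_top, EReal.coe_mul_top_of_pos hd,
      EReal.add_top_of_ne_bot hbot] at hb
    simp at hb
  obtain ⟨q, hq⟩ : ∃ q : NNReal, (q : ℝ≥0∞) = phi x := ⟨_, ENNReal.coe_toNNReal hp⟩
  have hcoe : ((phi x : ℝ≥0∞) : EReal) = ((q : ℝ) : EReal) := by
    rw [← hq]; rfl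
  have htop : f x ≠ ⊤ := by
    intro h
    rw [h, hcoe, ← EReal.coe_mul, EReal.top_add_coe] at hb
    simp at hb
  lift f x to ℝ using ⟨htop, hbot⟩ with u hu
  rw [hcoe] at ha hb
  exact ⟨u, q, q.2, rfl, by simp [← hq], by exact_mod_cast ha, by exact_mod_cast hb⟩

theorem ZeroDualityGap.exists_lt_Pen {X : Type*} {Q : Set X} {f : X → EReal}
    {phi : X → ℝ≥0∞} {fstar r : ℝ} (h : ZeroDualityGap Q f phi fstar) (hr : r < fstar) :
    ∃ c : ℝ, 0 ≤ c ∧ ∀ x ∈ Q, (r : EReal) ≤ Pen f phi c x := by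
  have h1 : (r : EReal) < ⨆ c : ℝ, ⨆ _ : (0 : ℝ) ≤ c, ⨅ x ∈ Q, Pen f phi c x := by
    rw [h]
    exact_mod_cast hr
  obtain ⟨c, h2⟩ := lt_iSup_iff.1 h1
  obtain ⟨hc, h3⟩ := lt_iSup_iff.1 h2
  exact ⟨c, hc, fun x hx => h3.le.trans (iInf₂_le x hx)⟩

section Sequences

variable {X : Type*} {Q : Set X} {f : X → EReal} {phi : X → ℝ≥0∞} {fstar : ℝ} {c : ℕ → ℝ}
  {x : ℕ → X}

theorem ZeroDualityGap.tendsto_phi (h : ZeroDualityGap Q f phi fstar)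
    (hc : Tendsto c atTop atTop) (hxQ : ∀ n, x n ∈ Q)
    (hx : ∀ n, Pen f phi (c n) (x n) ≤ fstar) :
    Tendsto (fun n => phi (x n)) atTop (𝓝 0) := by
  obtain ⟨d, hd, hdQ⟩ := h.exists_lt_Pen (sub_one_lt fstar)
  have hlim : Tendsto (fun n => ENNReal.ofReal (c n - d)⁻¹) atTop (𝓝 0) := by
    have h1 := ENNReal.tendsto_ofReal
      (tendsto_inv_atTop_zero.comp (tendsto_atTop_add_const_right atTop (-d) hc))
    simpa [sub_eq_add_neg, Function.comp_def] using h1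
  refine tendsto_of_tendsto_of_tendsto_of_le_of_le' tendsto_const_nhds hlim
    (Eventually.of_forall fun _ => zero_le) ?_
  filter_upwards [hc.eventually_gt_atTop d] with n hn
  obtain ⟨u, p, hp, -, hphi, hl, hu⟩ :=
    exists_real_of_Pen_bounds (hd.trans_lt hn) (hdQ _ (hxQ n)) (hx n)
  rw [hphi]
  apply ENNReal.ofReal_le_ofReal
  rw [← one_div, le_div_iff₀ (sub_pos.2 hn)]
  linarith

theorem ZeroDualityGap.tendsto_objective (h : ZeroDualityGap Q f phi fstar)
    (hc : Tendsto c atTop atTop) (hxQ : ∀ n, x n ∈ Q)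
    (hx : ∀ n, Pen f phi (c n) (x n) ≤ fstar) :
    Tendsto (fun n => f (x n)) atTop (𝓝 (fstar : EReal)) := by
  refine tendsto_order.2 ⟨fun a ha => ?_, fun b hb => ?_⟩
  · obtain ⟨r, har, hr⟩ := EReal.lt_iff_exists_real_btwn.1 ha
    obtain ⟨s, hrs, hs⟩ := exists_between (EReal.coe_lt_coe_iff.1 hr)
    obtain ⟨d, hd, hdQ⟩ := h.exists_lt_Pen hs
    filter_upwards [hc.eventually_gt_atTop d,
      hc.eventually_gt_atTop (d + d * (fstar - s) / (s - r))] with n hn hn'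
    obtain ⟨u, p, hp, hf, -, hl, hu⟩ :=
      exists_real_of_Pen_bounds (hd.trans_lt hn) (hdQ _ (hxQ n)) (hx n)
    rw [hf]
    refine har.trans (EReal.coe_lt_coe_iff.2 ?_)
    have h1 : d * (fstar - s) < (c n - d) * (s - r) :=
      (div_lt_iff₀ (sub_pos.2 hrs)).1 (by linarith)
    have h2 : d * ((c n - d) * p) ≤ d * (fstar - s) :=
      mul_le_mul_of_nonneg_left (by linarith) hd
    have h3 : d * p < s - r :=
      lt_of_mul_lt_mul_left (by linarith [mul_left_comm d (c n - d) p]) (sub_pos.2 hn).le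
    linarith
  · filter_upwards [hc.eventually_ge_atTop 0] with n hn
    refine lt_of_le_of_lt ?_ hb
    refine le_trans ?_ (hx n)
    simpa [Pen] using Pen_mono_param f phi hn (x n)

end Sequences

/-- Once the penalty function is bounded below on `Q` by the optimal value, it is exact for
all larger parameters. -/
theorem globallyExactPen_of_le_Pen {X : Type*} {M Q : Set X} {f : X → EReal}
    {phi : X → ℝ≥0∞} {fstar c : ℝ} (hphi : IsPenaltyTerm M Q phi)
    (hne : (argminP M Q f fstar).Nonempty) (hc : 0 ≤ c)
    (h : ∀ x ∈ Q, (fstar : EReal) ≤ Pen f phi c x) : GloballyExactPen M Q f phi fstar := by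
  refine ⟨c + 1, by linarith, fun d hd => Subset.antisymm ?_ ?_⟩
  · rintro x ⟨hxQ, hx⟩
    obtain ⟨p, hp⟩ := hne
    have hle := hx p hp.1.2
    rw [Pen_of_mem_argminP hphi hp] at hle
    obtain ⟨u, q, hq, hf, hphix, hl, hu⟩ :=
      exists_real_of_Pen_bounds (by linarith : 0 < d) (h x hxQ) hle
    have hq0 : q = 0 := by nlinarith
    subst hq0
    refine ⟨⟨(hphi x hxQ).1 (by simpa using hphix), hxQ⟩, ?_⟩
    rw [hf]
    norm_cast
    linarith
  · intro x hx
    refine ⟨hx.1.2, fun y hy => ?_⟩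
    rw [Pen_of_mem_argminP hphi hx]
    exact (h y hy).trans (Pen_mono_param f phi (by linarith) y)

theorem GloballyExactPen.zeroDualityGap {X : Type*} {M Q : Set X} {f : X → EReal}
    {phi : X → ℝ≥0∞} {fstar : ℝ} (hphi : IsPenaltyTerm M Q phi)
    (hne : (argminP M Q f fstar).Nonempty) (h : GloballyExactPen M Q f phi fstar) :
    ZeroDualityGap Q f phi fstar := by
  obtain ⟨c, hc, hmin⟩ := h
  obtain ⟨p, hp⟩ := hne
  refine le_antisymm (iSup₂_le fun d _ => ?_) (le_iSup₂_of_le c hc (le_iInf₂ fun y hy => ?_))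
  · exact (iInf₂_le p hp.1.2).trans (Pen_of_mem_argminP hphi hp d).le
  · rw [← Pen_of_mem_argminP hphi hp c]
    exact ((hmin c le_rfl).symm.subset hp).2 y hy

/-- localization principle for penalty functions I. For a problem
Levitin-Polyak well-posed with respect to `phi`, the penalty function is globally exact
iff it has the zero duality gap property, attains a global minimum on `Q` for all
sufficiently large `c`, and is locally exact at every globally optimal solution. -/
theorem stmt12 {X : Type*} [MetricSpace X] (M Q : Set X) (f : X → EReal) (phi : X → ℝ≥0∞)
    (fstar : ℝ)
    (hM : M.Nonempty) (hQ : Q.Nonempty) (hfeas : (M ∩ Q).Nonempty)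
    (hphi : IsPenaltyTerm M Q phi)
    (hopt : (⨅ x ∈ M ∩ Q, f x) = (fstar : EReal))
    (hwp : LevitinPolyakWPwrt M Q f phi fstar) :
    GloballyExactPen M Q f phi fstar ↔
      ZeroDualityGap Q f phi fstar ∧
        (∃ c₀ : ℝ, 0 ≤ c₀ ∧ ∀ c ≥ c₀, AttainsGlobMin (Pen f phi c) Q) ∧
        (∀ x₀ ∈ argminP M Q f fstar, LocallyExactAt f phi Q x₀) := by
  obtain ⟨hne, hseq⟩ := hwp
  constructor
  · intro h
    refine ⟨h.zeroDualityGap hphi hne, ?_⟩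
    obtain ⟨cs, hcs, hmin⟩ := h
    obtain ⟨p, hp⟩ := hne
    refine ⟨⟨cs, hcs, fun c hc => ⟨p, (hmin c hc).symm.subset hp⟩⟩,
      fun x₀ hx₀ => ⟨cs, hcs, fun c hc => ⟨1, one_pos, fun x hx _ => ?_⟩⟩⟩
    exact ((hmin c hc).symm.subset hx₀).2 x hx
  · rintro ⟨hgap, ⟨c₀, hc₀, hatt⟩, hloc⟩
    have hge : ∀ n : ℕ, c₀ ≤ c₀ + n := fun n => le_add_of_nonneg_right n.cast_nonneg
    choose x hxQ hxmin using fun n : ℕ => hatt (c₀ + n) (hge n)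
    have hc : Tendsto (fun n : ℕ => c₀ + n) atTop atTop :=
      tendsto_atTop_add_const_left _ _ tendsto_natCast_atTop_atTop
    have hx : ∀ n : ℕ, Pen f phi (c₀ + n) (x n) ≤ fstar := by
      obtain ⟨p, hp⟩ := hne
      exact fun n => (hxmin n p hp.1.2).trans (Pen_of_mem_argminP hphi hp _).le
    obtain ⟨σ, p, hσ, hp, hlim⟩ :=
      hseq x (hgap.tendsto_objective hc hxQ hx) (hgap.tendsto_phi hc hxQ hx)
    obtain ⟨cs, hcs, hmin⟩ := hloc p hp
    obtain ⟨r, hr, hball⟩ := hmin cs le_rfl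
    obtain ⟨k, hk, hck⟩ := ((hlim.eventually (Metric.closedBall_mem_nhds p hr)).and
      ((hc.comp hσ.tendsto_atTop).eventually_ge_atTop cs)).exists
    have hpk := hball _ (hxQ (σ k)) hk
    rw [Pen_of_mem_argminP hphi hp] at hpk
    exact globallyExactPen_of_le_Pen hphi hne (hc₀.trans (hge (σ k))) fun y hy =>
      (hpk.trans (Pen_mono_param f phi hck _)).trans (hxmin (σ k) y hy)
end
end

section
/- Let X be a reflexive Banach space, the set Q be weakly sequentially closed, the functions f and φ be weakly sequentially lower semicontinuous, and the problem (P) be weakly Levitin-Polyak well-posed in the extended sense. Then the penalty function F_c is globally exact if and only if the following two conditions hold: (1) F_c is strongly non-degenerate; (2) F_c is uniformly locally exact at globally optimal solutions of (P). -/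
open Metric Filter Topology Set ENNReal Bornology

noncomputable section

/-- Feasible points have zero penalty, so the penalty function agrees there with `f`. -/
lemma pen_eq_of_mem {X : Type*} {M Q : Set X} {f : X → EReal} {phi : X → ℝ≥0∞}
    (hphi : IsPenaltyTerm M Q phi) (c : ℝ) {x : X} (hx : x ∈ M ∩ Q) : Pen f phi c x = f x := by
  simp [Pen, (hphi x hx.2).2 hx.1]

lemma le_pen {X : Type*} (f : X → EReal) (phi : X → ℝ≥0∞) {c : ℝ} (hc : 0 ≤ c) (x : X) :
    f x ≤ Pen f phi c x :=
  le_add_of_nonneg_right (mul_nonneg (EReal.coe_nonneg.2 hc) (EReal.coe_ennreal_nonneg _))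

lemma pen_mono {X : Type*} (f : X → EReal) (phi : X → ℝ≥0∞) {c d : ℝ} (hcd : c ≤ d) (x : X) :
    Pen f phi c x ≤ Pen f phi d x :=
  add_le_add_right
    (mul_le_mul_of_nonneg_right (EReal.coe_le_coe_iff.2 hcd) (EReal.coe_ennreal_nonneg _)) _

/-- A finite value of the penalty function that does not increase with the penalty parameter
forces the penalty term to vanish. -/
lemma penalty_eq_zero_of_pen_le {X : Type*} {f : X → EReal} {phi : X → ℝ≥0∞} {c d a : ℝ}
    (hc : 0 ≤ c) (hcd : c < d) {x : X} (h₁ : (a : EReal) ≤ Pen f phi c x)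
    (h₂ : Pen f phi d x ≤ a) : phi x = 0 := by
  have hd : 0 < d := hc.trans_lt hcd
  have hbot : f x ≠ ⊥ := by
    intro h
    simp [Pen, h] at h₁
  have htop : f x ≠ ⊤ := by
    intro h
    have := (le_pen f phi hd.le x).trans h₂
    simp [h] at this
  unfold Pen at h₁ h₂
  lift f x to ℝ using ⟨htop, hbot⟩ with b
  induction hp : phi x using ENNReal.recTopCoe with
  | top =>
    rw [hp, EReal.coe_ennreal_top, EReal.coe_mul_top_of_pos hd, EReal.coe_add_top] at h₂
    simp at h₂
  | coe p =>
    rw [hp] at h₁ h₂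
    have e : (((p : ℝ≥0∞)) : EReal) = ((p : ℝ) : EReal) := rfl
    rw [e] at h₁ h₂
    norm_cast at h₁ h₂
    have hp0 : (p : ℝ) ≤ 0 := by
      have : (d - c) * (p : ℝ) ≤ 0 := by linarith
      by_contra! hlt
      exact absurd this (not_le.2 (mul_pos (sub_pos.2 hcd) hlt))
    have : p = 0 := le_antisymm (by exact_mod_cast hp0) zero_le
    simp [this]

/-- If the penalty function is bounded below by the optimal value for one parameter, then it is
globally exact. -/
lemma globallyExactPen_of_le {X : Type*} {M Q : Set X} {f : X → EReal} {phi : X → ℝ≥0∞}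
    {fstar : ℝ} (hphi : IsPenaltyTerm M Q phi) (hne : (argminP M Q f fstar).Nonempty)
    {c : ℝ} (hc : 0 ≤ c) (h : ∀ y ∈ Q, (fstar : EReal) ≤ Pen f phi c y) :
    GloballyExactPen M Q f phi fstar := by
  obtain ⟨p, hp, hfp⟩ := hne
  refine ⟨c + 1, by linarith, fun d hd => ?_⟩
  ext x
  constructor
  · rintro ⟨hxQ, hmin⟩
    have hle : Pen f phi d x ≤ fstar := by
      rw [← hfp, ← pen_eq_of_mem (f := f) hphi d hp]
      exact hmin p hp.2
    have hx : x ∈ M ∩ Q :=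
      ⟨(hphi x hxQ).1 (penalty_eq_zero_of_pen_le hc (by linarith) (h x hxQ) hle), hxQ⟩
    exact ⟨hx, le_antisymm ((le_pen f phi (by linarith) x).trans hle)
      ((h x hxQ).trans_eq (pen_eq_of_mem hphi c hx))⟩
  · rintro ⟨hx, hfx⟩
    refine ⟨hx.2, fun y hy => ?_⟩
    rw [pen_eq_of_mem hphi d hx, hfx]
    exact (h y hy).trans (pen_mono f phi (by linarith) y)

/-- The feasible set is weakly sequentially closed. -/
lemma weaklySeqClosed_feasible {X : Type*} [NormedAddCommGroup X] [NormedSpace ℝ X]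
    {M Q : Set X} {phi : X → ℝ≥0∞} (hphi : IsPenaltyTerm M Q phi) (hQcl : WeaklySeqClosed Q)
    (hphilsc : WeaklySeqLSC phi) : WeaklySeqClosed (M ∩ Q) := by
  intro x p hx hconv
  have hpQ := hQcl x p (fun n => (hx n).2) hconv
  have h := hphilsc x p hconv
  simp only [fun n => (hphi _ (hx n).2).2 (hx n).1, liminf_const] at h
  exact ⟨(hphi p hpQ).1 (le_antisymm h zero_le), hpQ⟩

/-- The weak limit of a sequence that approaches a weakly sequentially closed set in norm
belongs to that set. -/
lemma WeaklySeqClosed.mem_of_infDist_tendsto {X : Type*} [NormedAddCommGroup X]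
    [NormedSpace ℝ X] {S : Set X} (hS : WeaklySeqClosed S) (hne : S.Nonempty) {x : ℕ → X}
    {p : X} (hconv : WeakSeqConv x p) (hdist : Tendsto (fun n => infDist (x n) S) atTop (𝓝 0)) :
    p ∈ S := by
  have hex (n : ℕ) : ∃ w ∈ S, dist (x n) w < infDist (x n) S + 1 / ((n : ℝ) + 1) :=
    (infDist_lt_iff hne).1 (lt_add_of_pos_right _ Nat.one_div_pos_of_nat)
  choose w hwS hw using hex
  have hd : Tendsto (fun n => dist (x n) (w n)) atTop (𝓝 0) :=
    squeeze_zero (fun _ => dist_nonneg) (fun n => (hw n).le)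
      (by simpa using hdist.add tendsto_one_div_add_atTop_nhds_zero_nat)
  refine hS w p hwS fun l => ?_
  have hsub : Tendsto (fun n => x n - w n) atTop (𝓝 0) := by
    rw [tendsto_zero_iff_norm_tendsto_zero]
    simpa [dist_eq_norm] using hd
  simpa using (hconv l).sub ((l.continuous.tendsto 0).comp hsub)

/-- Let `X` be a reflexive Banach space, `Q` weakly sequentially closed,
`f` and `phi` weakly sequentially lsc, and (P) weakly Levitin-Polyak well-posed in the
extended sense. Then the penalty function is globally exact iff it is strongly
non-degenerate and uniformly locally exact at globally optimal solutions. -/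
theorem stmt16 {X : Type*} [NormedAddCommGroup X] [NormedSpace ℝ X] [CompleteSpace X]
    (hrefl : ReflexiveSeq X)
    (M Q : Set X) (f : X → EReal) (phi : X → ℝ≥0∞) (fstar : ℝ)
    (hM : M.Nonempty) (hQ : Q.Nonempty) (hfeas : (M ∩ Q).Nonempty)
    (hphi : IsPenaltyTerm M Q phi)
    (hopt : (⨅ x ∈ M ∩ Q, f x) = (fstar : EReal))
    (hQcl : WeaklySeqClosed Q)
    (hflsc : WeaklySeqLSC f)
    (hphilsc : WeaklySeqLSC phi)
    (hwp : WeakLevitinPolyakWPExt M Q f fstar) :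
    GloballyExactPen M Q f phi fstar ↔
      StronglyNondegenerate M Q f phi ∧
        UniformlyLocallyExact M Q f phi fstar := by
  have hlow : ∀ x ∈ M ∩ Q, (fstar : EReal) ≤ f x := fun x hx => hopt ▸ iInf₂_le x hx
  obtain ⟨p₀, hp₀, hfp₀⟩ := hwp.1
  constructor
  · rintro ⟨cs, hcs, hex⟩
    have hmin : ∀ x ∈ argminP M Q f fstar, ∀ c ≥ cs, ∀ y ∈ Q, Pen f phi c x ≤ Pen f phi c y := by
      intro x hx c hc
      rw [← hex c hc] at hx
      exact hx.2
    refine ⟨⟨cs, hcs, fun _ => p₀, fun c hc => ⟨hp₀.2, hmin p₀ ⟨hp₀, hfp₀⟩ c hc⟩, ?_, ?_⟩, ?_⟩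
    · exact isBounded_singleton.subset (image_subset_iff.2 fun _ _ => rfl)
    · simp [infDist_zero_of_mem hp₀]
    · have hloc : ∀ x ∈ argminP M Q f fstar, ∀ c ≥ cs, IsLocalMinOnSet (Pen f phi c) Q x :=
        fun x hx c hc => ⟨1, one_pos, fun y hy _ => hmin x hx c hc y hy⟩
      refine ⟨fun x hx => ⟨cs, hcs, hloc x hx⟩, cs + 1, 1, by linarith, one_pos,
        fun x hx => ⟨?_, ?_⟩⟩
      · have hle : penCStarAt f phi Q x ≤ cs := csInf_le ⟨0, fun _ h => h.1⟩ ⟨hcs, hloc x hx⟩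
        exact hle.trans_lt (lt_add_one cs)
      · exact le_sSup (mem_image_of_mem _
          ⟨one_pos, fun c hc y hy _ => hmin x hx c (by linarith) y hy⟩)
  · rintro ⟨⟨c₀, hc₀, xc, hxc, hbdd, hdist⟩, -, cs, rs, -, hrs, hunif⟩
    have hle : ∀ c ≥ c₀, f (xc c) ≤ fstar := fun c hc =>
      (le_pen f phi (hc₀.trans hc) _).trans
        (((hxc c hc).2 p₀ hp₀.2).trans_eq ((pen_eq_of_mem hphi c hp₀).trans hfp₀))
    have hge (n : ℕ) : c₀ ≤ c₀ + n := le_add_of_nonneg_right n.cast_nonneg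
    obtain ⟨σ, p, hσ, hconv⟩ := hrefl (fun n => xc (c₀ + n))
      (hbdd.subset (range_subset_iff.2 fun n => mem_image_of_mem xc (hge n)))
    have hc : Tendsto (fun k => c₀ + (σ k : ℝ)) atTop atTop :=
      tendsto_atTop_add_const_left _ _ (tendsto_natCast_atTop_atTop.comp hσ.tendsto_atTop)
    have hdist' := hdist.comp hc
    have hp : p ∈ M ∩ Q :=
      (weaklySeqClosed_feasible hphi hQcl hphilsc).mem_of_infDist_tendsto hfeas hconv hdist'
    have hf : Tendsto (fun k => f (xc (c₀ + σ k))) atTop (𝓝 (fstar : EReal)) :=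
      tendsto_of_le_liminf_of_limsup_le ((hlow p hp).trans (hflsc _ p hconv))
        (limsup_le_of_le (h := Eventually.of_forall fun k => hle _ (hge (σ k))))
    have hsol := hwp.2 _ hf hdist'
    obtain ⟨k, hkd, hkc⟩ := ((hsol.eventually_lt_const hrs).and (hc.eventually_ge_atTop cs)).exists
    obtain ⟨q, hq, hqd⟩ := (infDist_lt_iff hwp.1).1 hkd
    obtain ⟨-, ⟨r, ⟨-, hr⟩, rfl⟩, hdr⟩ :=
      lt_sSup_iff.1 ((EReal.coe_lt_coe_iff.2 hqd).trans_le (hunif q hq).2)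
    have hmin := hxc _ (hge (σ k))
    refine globallyExactPen_of_le hphi hwp.1 (hc₀.trans (hge (σ k))) fun y hy => ?_
    have hqk := hr _ hkc _ hmin.1 (EReal.coe_lt_coe_iff.1 hdr).le
    rw [pen_eq_of_mem hphi _ hq.1, hq.2] at hqk
    exact hqk.trans (hmin.2 y hy)
end
end
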